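/- Let β ∈ (0,1) be irrational with continued fraction expansion β = [0; d_1, d_2, …], convergents p_k/q_k, and let G be the Gauss map. Suppose (k_i)_{i∈ℕ} is a strictly increasing sequence of positive integers such that q_{k_i−1}/q_{k_i} → w and G^{k_i}(β) → θ as i → ∞, where θ ∈ (0,1) and 1/θ is not an integer. Then (p_{k_i+1} + q_{k_i+1}) · (1/(β+1)) · |β·q_{k_i} − p_{k_i}| → (⌊1/θ⌋ + w)·θ / (1 + θ·w) as i → ∞. -/

import Mathlib

open Function

/-- The Gauss map `G(t) = 1/t − ⌊1/t⌋`, the fractional part of `1/t`. -/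
noncomputable def gaussMap (t : ℝ) : ℝ := Int.fract (1 / t)

/-- `cfP β k` is the continued fraction numerator `p_{k-1}` of `β`:
`p_{-1} = 1`, `p_0 = 0`, `p_k = d_k p_{k-1} + p_{k-2}` where `d_k = ⌊1/G^{k-1}(β)⌋`
are the partial quotients of `β = [0; d_1, d_2, …]`. -/
noncomputable def cfP (β : ℝ) : ℕ → ℝ
  | 0 => 1
  | 1 => 0
  | (k + 2) => (⌊1 / (gaussMap^[k] β)⌋₊ : ℝ) * cfP β (k + 1) + cfP β k

/-- `cfQ β k` is the continued fraction denominator `q_{k-1}` of `β`: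
`q_{-1} = 0`, `q_0 = 1`, `q_k = d_k q_{k-1} + q_{k-2}` where `d_k = ⌊1/G^{k-1}(β)⌋`
are the partial quotients of `β = [0; d_1, d_2, …]`. -/
noncomputable def cfQ (β : ℝ) : ℕ → ℝ
  | 0 => 0
  | 1 => 1
  | (k + 2) => (⌊1 / (gaussMap^[k] β)⌋₊ : ℝ) * cfQ β (k + 1) + cfQ β k


open Filter Topology

lemma gaussMap_iterate_mem {β : ℝ} (hirr : Irrational β) (h0 : 0 < β) (h1 : β < 1) (k : ℕ) :
    Irrational (gaussMap^[k] β) ∧ 0 < gaussMap^[k] β ∧ gaussMap^[k] β < 1 := by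
  induction k with
  | zero => exact ⟨hirr, h0, h1⟩
  | succ k ih =>
    rw [iterate_succ_apply']
    obtain ⟨hi, -, -⟩ := ih
    have hfr : Irrational (gaussMap (gaussMap^[k] β)) := by
      unfold gaussMap Int.fract
      rw [one_div]
      exact hi.inv.sub_intCast _
    exact ⟨hfr, lt_of_le_of_ne (Int.fract_nonneg _) hfr.ne_zero.symm, Int.fract_lt_one _⟩

lemma one_div_eq_floor_add_gaussMap {t : ℝ} (ht : 0 < t) :
    1 / t = (⌊1 / t⌋₊ : ℝ) + gaussMap t := by
  unfold gaussMap
  rw [natCast_floor_eq_intCast_floor (by positivity), Int.floor_add_fract]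

/-- The identity `β (q_k + G^k(β) q_{k-1}) = p_k + G^k(β) p_{k-1}`. -/
lemma mul_cfQ_add_eq_cfP_add {β : ℝ} (hirr : Irrational β) (h0 : 0 < β) (h1 : β < 1) (k : ℕ) :
    β * (cfQ β (k + 1) + gaussMap^[k] β * cfQ β k)
      = cfP β (k + 1) + gaussMap^[k] β * cfP β k := by
  induction k with
  | zero => simp [cfP, cfQ]
  | succ k ih =>
    obtain ⟨-, ht, -⟩ := gaussMap_iterate_mem hirr h0 h1 k
    have hfl := one_div_eq_floor_add_gaussMap ht
    simp only [iterate_succ_apply', cfP, cfQ]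
    set t := gaussMap^[k] β
    have hg : gaussMap t = 1 / t - (⌊1 / t⌋₊ : ℝ) := by linarith
    rw [hg]
    field_simp
    linear_combination ih

lemma abs_cfP_mul_cfQ_sub (β : ℝ) (k : ℕ) :
    |cfP β k * cfQ β (k + 1) - cfP β (k + 1) * cfQ β k| = 1 := by
  induction k with
  | zero => simp [cfP, cfQ]
  | succ k ih =>
    rw [← ih, ← abs_neg]
    simp only [cfP, cfQ]
    congr 1
    ring

lemma cfQ_bounds {β : ℝ} (hirr : Irrational β) (h0 : 0 < β) (h1 : β < 1) (k : ℕ) :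
    0 ≤ cfQ β k ∧ 1 ≤ cfQ β (k + 1) ∧ (k : ℝ) ≤ cfQ β (k + 1) ∧
      (k : ℝ) + 1 ≤ cfQ β (k + 2) := by
  have hd (k : ℕ) : (1 : ℝ) ≤ (⌊1 / (gaussMap^[k] β)⌋₊ : ℝ) := by
    obtain ⟨-, ht, ht1⟩ := gaussMap_iterate_mem hirr h0 h1 k
    exact_mod_cast Nat.le_floor (by simpa using (one_le_div ht).2 ht1.le)
  induction k with
  | zero => simpa [cfQ] using hd 0
  | succ k ih =>
    obtain ⟨a, b, c, d⟩ := ih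
    have e : cfQ β (k + 3)
        = (⌊1 / (gaussMap^[k + 1] β)⌋₊ : ℝ) * cfQ β (k + 2) + cfQ β (k + 1) := rfl
    have hk : (0 : ℝ) ≤ k := k.cast_nonneg
    have := mul_le_mul_of_nonneg_right (hd (k + 1)) (show 0 ≤ cfQ β (k + 2) by linarith)
    push_cast
    refine ⟨by linarith, ?_, d, ?_⟩
    · change 1 ≤ cfQ β (k + 2)
      linarith
    · change (k : ℝ) + 1 + 1 ≤ cfQ β (k + 3)
      linarith

/-- The approximation error `|β q_k - p_k| = G^k(β) / (q_k + G^k(β) q_{k-1})`. -/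
lemma abs_mul_cfQ_sub_cfP {β : ℝ} (hirr : Irrational β) (h0 : 0 < β) (h1 : β < 1) (k : ℕ) :
    |β * cfQ β (k + 1) - cfP β (k + 1)|
      = gaussMap^[k] β / (cfQ β (k + 1) + gaussMap^[k] β * cfQ β k) := by
  obtain ⟨-, ht, -⟩ := gaussMap_iterate_mem hirr h0 h1 k
  obtain ⟨hQ, hQ1, -, -⟩ := cfQ_bounds hirr h0 h1 k
  have hD : 0 < cfQ β (k + 1) + gaussMap^[k] β * cfQ β k := by positivity
  have hmain : (β * cfQ β (k + 1) - cfP β (k + 1))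
      * (cfQ β (k + 1) + gaussMap^[k] β * cfQ β k)
      = gaussMap^[k] β * (cfP β k * cfQ β (k + 1) - cfP β (k + 1) * cfQ β k) := by
    linear_combination cfQ β (k + 1) * mul_cfQ_add_eq_cfP_add hirr h0 h1 k
  have habs := congrArg abs hmain
  rw [abs_mul, abs_mul, abs_cfP_mul_cfQ_sub, abs_of_pos hD, abs_of_pos ht, mul_one] at habs
  exact (eq_div_iff hD.ne').2 habs

lemma abs_mul_cfQ_sub_cfP_le {β : ℝ} (hirr : Irrational β) (h0 : 0 < β) (h1 : β < 1) (k : ℕ) :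
    |β * cfQ β (k + 1) - cfP β (k + 1)| ≤ 1 / cfQ β (k + 1) := by
  obtain ⟨-, ht, ht1⟩ := gaussMap_iterate_mem hirr h0 h1 k
  obtain ⟨hQ, hQ1, -, -⟩ := cfQ_bounds hirr h0 h1 k
  rw [abs_mul_cfQ_sub_cfP hirr h0 h1 k]
  have : 0 ≤ gaussMap^[k] β * cfQ β k := by positivity
  exact div_le_div₀ zero_le_one ht1.le (by linarith) (by linarith)

lemma tendsto_mul_cfQ_sub_cfP {β : ℝ} (hirr : Irrational β) (h0 : 0 < β) (h1 : β < 1) :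
    Tendsto (fun k => β * cfQ β (k + 1) - cfP β (k + 1)) atTop (𝓝 0) := by
  have hQ : Tendsto (fun k => cfQ β (k + 1)) atTop atTop :=
    tendsto_atTop_mono (fun k => (cfQ_bounds hirr h0 h1 k).2.2.1) tendsto_natCast_atTop_atTop
  refine squeeze_zero_norm (fun k => abs_mul_cfQ_sub_cfP_le hirr h0 h1 k) ?_
  exact hQ.const_div_atTop 1

lemma tendsto_natCast_floor {ι : Type*} {l : Filter ι} {f : ι → ℝ} {x : ℝ} (hx0 : 0 ≤ x)
    (hx : ¬ ∃ m : ℤ, x = (m : ℝ)) (hf : Tendsto f l (𝓝 x)) :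
    Tendsto (fun i => (⌊f i⌋₊ : ℝ)) l (𝓝 (⌊x⌋₊ : ℝ)) := by
  have hlt : (⌊x⌋₊ : ℝ) < x :=
    lt_of_le_of_ne (Nat.floor_le hx0) fun h => hx ⟨⌊x⌋₊, by simpa using h.symm⟩
  refine tendsto_const_nhds.congr' ?_
  filter_upwards [hf.eventually_const_lt hlt, hf.eventually_lt_const (Nat.lt_floor_add_one x)]
    with i h₁ h₂
  rw [(Nat.floor_eq_iff ((Nat.cast_nonneg _).trans h₁.le)).2 ⟨h₁.le, h₂⟩]

/-- For irrational `β ∈ (0,1)` with convergents `p_k/q_k`, Gauss map `G`,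
and a strictly increasing sequence `(k_i)` of positive integers with
`q_{k_i−1}/q_{k_i} → w` and `G^{k_i}(β) → θ ∈ (0,1)` where `1/θ` is not an integer,
one has `(p_{k_i+1} + q_{k_i+1})·(1/(β+1))·|β·q_{k_i} − p_{k_i}| →
(⌊1/θ⌋ + w)·θ/(1 + θ·w)`. -/
theorem stmt_16 (β : ℝ) (hirr : Irrational β) (h0 : 0 < β) (h1 : β < 1)
    (k : ℕ → ℕ) (hk : StrictMono k) (hk1 : ∀ i, 1 ≤ k i)
    (w θ : ℝ) (hθ0 : 0 < θ) (hθ1 : θ < 1)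
    (hθint : ¬ ∃ m : ℤ, 1 / θ = (m : ℝ))
    (hw : Filter.Tendsto (fun i => cfQ β (k i) / cfQ β (k i + 1)) Filter.atTop (nhds w))
    (hθ : Filter.Tendsto (fun i => gaussMap^[k i] β) Filter.atTop (nhds θ)) :
    Filter.Tendsto
      (fun i => (cfP β (k i + 2) + cfQ β (k i + 2)) * (1 / (β + 1)) *
        |β * cfQ β (k i + 1) - cfP β (k i + 1)|)
      Filter.atTop (nhds (((⌊1 / θ⌋₊ : ℝ) + w) * θ / (1 + θ * w))) := by
  have hkt : Tendsto k atTop atTop := hk.tendsto_atTop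
  have he := tendsto_mul_cfQ_sub_cfP hirr h0 h1
  have hw0 : 0 ≤ w := ge_of_tendsto' hw fun i =>
    div_nonneg (cfQ_bounds hirr h0 h1 (k i)).1
      (zero_le_one.trans (cfQ_bounds hirr h0 h1 (k i)).2.1)
  have hfl : Tendsto (fun i => (⌊1 / gaussMap^[k i] β⌋₊ : ℝ)) atTop (𝓝 (⌊1 / θ⌋₊ : ℝ)) :=
    tendsto_natCast_floor (by positivity) hθint (tendsto_const_nhds.div hθ hθ0.ne')
  have hmain := ((hfl.add hw).mul hθ).div (tendsto_const_nhds.add (hθ.mul hw))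
    (show (1 : ℝ) + θ * w ≠ 0 by positivity)
  have herr := (((he.comp (tendsto_add_atTop_nat 1)).comp hkt).mul
    (he.comp hkt).abs).mul_const (1 / (β + 1))
  have htot := hmain.sub herr
  simp only [abs_zero, mul_zero, zero_mul, sub_zero] at htot
  refine htot.congr fun i => ?_
  obtain ⟨-, ht, -⟩ := gaussMap_iterate_mem hirr h0 h1 (k i)
  obtain ⟨hQ, hQ1, -, -⟩ := cfQ_bounds hirr h0 h1 (k i)
  have hQpos : 0 < cfQ β (k i + 1) := by linarith
  have hratio : ((⌊1 / gaussMap^[k i] β⌋₊ : ℝ) + cfQ β (k i) / cfQ β (k i + 1))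
        * gaussMap^[k i] β / (1 + gaussMap^[k i] β * (cfQ β (k i) / cfQ β (k i + 1)))
      = cfQ β (k i + 2) * |β * cfQ β (k i + 1) - cfP β (k i + 1)| := by
    have hD : 0 < cfQ β (k i + 1) + gaussMap^[k i] β * cfQ β (k i) := by positivity
    have hDdiv : 1 + gaussMap^[k i] β * (cfQ β (k i) / cfQ β (k i + 1))
        = (cfQ β (k i + 1) + gaussMap^[k i] β * cfQ β (k i)) / cfQ β (k i + 1) := by
      field_simp
    rw [abs_mul_cfQ_sub_cfP hirr h0 h1 (k i), cfQ, hDdiv]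
    field_simp
  simp only [comp_apply, Pi.div_apply]
  rw [hratio]
  field_simp
  ring
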